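/- Even central moments of the number of order-2 branches (Lemma 3, even case): for every fixed s ≥ 0, the expectation ⟨(S_{2,n} − n/4)^{2s}⟩ under P_n is asymptotically equivalent, as n → ∞, to ((2s−1)!!/4^{2s})·n^s. -/

import Mathlib

open MeasureTheory ProbabilityTheory Filter
open scoped NNReal Topology

/-- Binary trees: every internal node has exactly two children. -/
inductive BinTree : Type
  | leaf : BinTree
  | node : BinTree → BinTree → BinTree
  deriving DecidableEq

namespace BinTree

/-- The magnitude of a binary tree is its number of leaves. -/
def magnitude : BinTree → ℕ
  | leaf => 1
  | node l r => magnitude l + magnitude r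

/-- The Horton–Strahler order of (the root of) a binary tree:
leaves have order 1; a node whose two children have distinct orders has the max of the two;
a node whose two children have equal order `r` has order `r + 1`. -/
def ord : BinTree → ℕ
  | leaf => 1
  | node l r => if ord l = ord r then ord l + 1 else max (ord l) (ord r)

/-- `branches k τ` is `S_{k,n}(τ)`, the number of Horton–Strahler branches of order `k`
in `τ`, i.e. the number of maximal connected paths of nodes of order `k`.  It counts the
nodes of order `k` that head a branch: a new branch head of order `ord l + 1` is created
exactly at a node whose two children have equal order `ord l`, and every leaf heads an
order-1 branch. -/
def branches (k : ℕ) : BinTree → ℕ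
  | leaf => if k = 1 then 1 else 0
  | node l r => branches k l + branches k r +
      (if ord l = ord r ∧ ord l + 1 = k then 1 else 0)

end BinTree

/-- `treesOf n` is the finite set `Ω_n` of binary trees of magnitude `n`. -/
def treesOf : ℕ → Finset BinTree
  | 0 => ∅
  | 1 => {BinTree.leaf}
  | (n+2) => (Finset.range (n+1)).attach.biUnion fun k =>
      ((treesOf (k.1+1)) ×ˢ (treesOf (n+1-k.1))).image fun p => BinTree.node p.1 p.2
  decreasing_by
  · have := Finset.mem_range.mp k.2; omega
  · omega

/-- Expectation `⟨f⟩` under the uniform probability measure `P_n` on `Ω_n` (the random model). -/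
noncomputable def expect (n : ℕ) (f : BinTree → ℝ) : ℝ :=
  (∑ τ ∈ treesOf n, f τ) / (treesOf n).card

open Asymptotics

lemma natCast_pow_isBigO_pow {p q : ℕ} (h : p ≤ q) :
    (fun n : ℕ => (n : ℝ) ^ p) =O[atTop] fun n => (n : ℝ) ^ q := by
  refine IsBigO.of_bound 1 ?_
  filter_upwards [eventually_ge_atTop 1] with n hn
  have : (1 : ℝ) ≤ n := by exact_mod_cast hn
  rw [one_mul, Real.norm_of_nonneg (by positivity), Real.norm_of_nonneg (by positivity)]
  exact pow_le_pow_right₀ this h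

lemma isBigO_pow_of_linear_mul {f : ℕ → ℝ} {c : ℝ} {p : ℕ}
    (h : (fun n : ℕ => (4 * (n : ℝ) - c) * f n) =O[atTop] fun n => (n : ℝ) ^ (p + 1)) :
    f =O[atTop] fun n => (n : ℝ) ^ p := by
  obtain ⟨C, hC⟩ := h.bound
  refine IsBigO.of_bound C ?_
  have hlarge : ∀ᶠ n : ℕ in atTop, c ≤ (n : ℝ) :=
    tendsto_natCast_atTop_atTop.eventually_ge_atTop c
  filter_upwards [hC, hlarge, eventually_ge_atTop 1] with n hn hcn h1
  have hpos : (0 : ℝ) < n := by exact_mod_cast h1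
  rw [norm_mul, Real.norm_of_nonneg (show 0 ≤ 4 * (n : ℝ) - c by linarith),
    Real.norm_of_nonneg (show 0 ≤ (n : ℝ) ^ (p + 1) by positivity), pow_succ] at hn
  rw [Real.norm_of_nonneg (show 0 ≤ (n : ℝ) ^ p by positivity)]
  refine le_of_mul_le_mul_left ?_ hpos
  have : (n : ℝ) * ‖f n‖ ≤ (4 * (n : ℝ) - c) * ‖f n‖ :=
    mul_le_mul_of_nonneg_right (by linarith) (norm_nonneg _)
  linarith

lemma quadratic_isBigO :
    (fun n : ℕ => (n : ℝ) ^ 2 / 4 - (n : ℝ) / 2) =O[atTop] fun n => (n : ℝ) ^ 2 := by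
  have h2 : (fun n : ℕ => (1 / 4 : ℝ) * (n : ℝ) ^ 2) =O[atTop] fun n => (n : ℝ) ^ 2 :=
    (isBigO_refl _ _).const_mul_left _
  have h1 : (fun n : ℕ => (1 / 2 : ℝ) * (n : ℝ) ^ 1) =O[atTop] fun n => (n : ℝ) ^ 2 :=
    (natCast_pow_isBigO_pow (by norm_num)).const_mul_left _
  exact (h2.sub h1).congr_left fun n => by ring

lemma linear_isBigO (α β : ℝ) :
    (fun n : ℕ => α + β * (n : ℝ)) =O[atTop] fun n => (n : ℝ) ^ 1 := by
  have h1 : (fun n : ℕ => β * (n : ℝ) ^ 1) =O[atTop] fun n => (n : ℝ) ^ 1 :=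
    (isBigO_refl _ _).const_mul_left _
  have h0 : (fun n : ℕ => α * (n : ℝ) ^ 0) =O[atTop] fun n => (n : ℝ) ^ 1 :=
    (natCast_pow_isBigO_pow (by norm_num)).const_mul_left _
  exact (h0.add h1).congr_left fun n => by ring

lemma mul_isBigO_pow {f g : ℕ → ℝ} {p q r : ℕ}
    (hf : f =O[atTop] fun n => (n : ℝ) ^ p) (hg : g =O[atTop] fun n => (n : ℝ) ^ q)
    (h : p + q ≤ r) : (fun n => f n * g n) =O[atTop] fun n => (n : ℝ) ^ r := by
  refine ((hf.mul hg).congr_right fun n => ?_).trans (natCast_pow_isBigO_pow h)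
  rw [pow_add]

/-- The part of the moment recurrence that only involves moments of order below the two top ones. -/
noncomputable def lowerTerms (a : ℕ → ℕ → ℝ) (k n : ℕ) : ℝ :=
  ∑ j ∈ Finset.range k, ((k + 1).choose j : ℝ) *
    (((n : ℝ) ^ 2 / 4 - (n : ℝ) / 2) * a j n + (2 + -2 * (n : ℝ)) * a (j + 1) n + 4 * a (j + 2) n)

lemma lowerTerms_isBigO {a : ℕ → ℕ → ℝ} {k r : ℕ}
    (ha : ∀ j ≤ k + 1, a j =O[atTop] fun n => (n : ℝ) ^ (j / 2)) (hr : (k + 3) / 2 ≤ r) :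
    lowerTerms a k =O[atTop] fun n => (n : ℝ) ^ r := by
  unfold lowerTerms
  refine IsBigO.fun_sum fun j hj => ?_
  have hj := Finset.mem_range.mp hj
  refine IsBigO.const_mul_left ?_ _
  refine ((mul_isBigO_pow quadratic_isBigO (ha j (by omega)) (by omega)).add
    (mul_isBigO_pow (linear_isBigO 2 (-2)) (ha (j + 1) (by omega)) (by omega))).add ?_
  exact ((ha (j + 2) (by omega)).trans (natCast_pow_isBigO_pow (by omega))).const_mul_left _

section MomentRecurrence

variable {a : ℕ → ℕ → ℝ}

lemma moments_isBigO
    (h0 : ∀ᶠ n in atTop, a 0 n = 1)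
    (h1 : ∀ n : ℕ, (4 * (n : ℝ) - 6) * a 1 n = (0 + 1 / 2 * (n : ℝ)) * a 0 n)
    (hrec : ∀ k n : ℕ, (4 * (n : ℝ) - (6 + 4 * ((k : ℝ) + 1))) * a (k + 2) n =
      (0 + 1 / 2 * (n : ℝ)) * a (k + 1) n + ((k : ℝ) + 1) *
        (((n : ℝ) ^ 2 / 4 - (n : ℝ) / 2) * a k n + (2 + -2 * (n : ℝ)) * a (k + 1) n)
        + lowerTerms a k n) (j : ℕ) :
    a j =O[atTop] fun n => (n : ℝ) ^ (j / 2) := by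
  induction j using Nat.strong_induction_on with
  | _ j ih =>
    match j, ih with
    | 0, _ =>
      refine IsBigO.of_bound 1 ?_
      filter_upwards [h0] with n hn
      simp [hn]
    | 1, ih =>
      refine isBigO_pow_of_linear_mul (c := 6) ?_
      simp only [h1]
      exact mul_isBigO_pow (linear_isBigO _ _) (ih 0 (by omega)) (by omega)
    | k + 2, ih =>
      refine isBigO_pow_of_linear_mul (c := 6 + 4 * ((k : ℝ) + 1)) ?_
      simp only [hrec]
      refine ((mul_isBigO_pow (linear_isBigO _ _) (ih (k + 1) (by omega)) (by omega)).add
        (IsBigO.const_mul_left ?_ _)).add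
        (lowerTerms_isBigO (fun j hj => ih j (by omega)) (by omega))
      exact (mul_isBigO_pow quadratic_isBigO (ih k (by omega)) (by omega)).add
        (mul_isBigO_pow (linear_isBigO _ _) (ih (k + 1) (by omega)) (by omega))

lemma even_moments_tendsto
    (h0 : ∀ᶠ n in atTop, a 0 n = 1)
    (h1 : ∀ n : ℕ, (4 * (n : ℝ) - 6) * a 1 n = (0 + 1 / 2 * (n : ℝ)) * a 0 n)
    (hrec : ∀ k n : ℕ, (4 * (n : ℝ) - (6 + 4 * ((k : ℝ) + 1))) * a (k + 2) n =
      (0 + 1 / 2 * (n : ℝ)) * a (k + 1) n + ((k : ℝ) + 1) *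
        (((n : ℝ) ^ 2 / 4 - (n : ℝ) / 2) * a k n + (2 + -2 * (n : ℝ)) * a (k + 1) n)
        + lowerTerms a k n) (s : ℕ) :
    Tendsto (fun n : ℕ => a (2 * s) n / (n : ℝ) ^ s) atTop
      (𝓝 ((Nat.doubleFactorial (2 * s - 1) : ℝ) / 4 ^ (2 * s))) := by
  have hO := moments_isBigO h0 h1 hrec
  induction s with
  | zero =>
    refine tendsto_const_nhds.congr' ?_
    filter_upwards [h0] with n hn
    simp [hn]
  | succ s ih =>
    set c : ℝ := 6 + 4 * (((2 * s : ℕ) : ℝ) + 1) with hc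
    set r : ℕ → ℝ := fun n => (4 * (n : ℝ) - c) * a (2 * s + 2) n -
      (2 * (s : ℝ) + 1) / 4 * ((n : ℝ) ^ 2 * a (2 * s) n) with hr
    have hrO : r =O[atTop] fun n => (n : ℝ) ^ (s + 1) := by
      have hlow : lowerTerms a (2 * s) =O[atTop] fun n => (n : ℝ) ^ (s + 1) :=
        lowerTerms_isBigO (fun j _ => hO j) (by omega)
      have e1 := mul_isBigO_pow (r := s + 1) (linear_isBigO 0 (1 / 2)) (hO (2 * s + 1)) (by omega)
      have e2 := mul_isBigO_pow (r := s + 1) (linear_isBigO 0 (-1 / 2)) (hO (2 * s)) (by omega)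
      have e3 := mul_isBigO_pow (r := s + 1) (linear_isBigO 2 (-2)) (hO (2 * s + 1)) (by omega)
      refine ((e1.add ((e2.add e3).const_mul_left (2 * (s : ℝ) + 1))).add hlow).congr_left ?_
      intro n
      have := hrec (2 * s) n
      simp only [hr, hc, this]
      push_cast
      ring
    have hinv : Tendsto (fun n : ℕ => ((n : ℝ))⁻¹) atTop (𝓝 0) :=
      tendsto_inv_atTop_nhds_zero_nat
    have hrlim : Tendsto (fun n : ℕ => r n / (n : ℝ) ^ (s + 2)) atTop (𝓝 0) := by
      refine IsLittleO.tendsto_div_nhds_zero (hrO.trans_isLittleO ?_)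
      exact (isLittleO_pow_pow_atTop_of_lt (𝕜 := ℝ) (by omega)).comp_tendsto
        tendsto_natCast_atTop_atTop
    have hden : Tendsto (fun n : ℕ => 4 - c * ((n : ℝ))⁻¹) atTop (𝓝 4) := by
      simpa using tendsto_const_nhds.sub (hinv.const_mul c)
    have hmain := ((ih.const_mul ((2 * (s : ℝ) + 1) / 4)).add hrlim).div hden (by norm_num)
    have hval : ((2 * (s : ℝ) + 1) / 4 *
        ((Nat.doubleFactorial (2 * s - 1) : ℝ) / 4 ^ (2 * s)) + 0) / 4 =
        (Nat.doubleFactorial (2 * (s + 1) - 1) : ℝ) / 4 ^ (2 * (s + 1)) := by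
      have hdf : Nat.doubleFactorial (2 * (s + 1) - 1) =
          (2 * s + 1) * Nat.doubleFactorial (2 * s - 1) := by
        cases s with
        | zero => rfl
        | succ t => exact Nat.doubleFactorial_add_two (2 * t + 1)
      rw [hdf, mul_add 2 s 1, pow_add]
      push_cast
      field_simp
      ring
    rw [hval] at hmain
    refine hmain.congr' ?_
    filter_upwards [tendsto_natCast_atTop_atTop.eventually_gt_atTop c,
      eventually_ge_atTop 1] with n hn hn1
    have hpos : (0 : ℝ) < n := by exact_mod_cast hn1
    have hne : (4 * (n : ℝ) - c) ≠ 0 := by nlinarith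
    have hne' : 4 - c * ((n : ℝ))⁻¹ ≠ 0 := by
      intro h
      apply hne
      field_simp at h
      linarith
    rw [Pi.div_apply, div_eq_iff hne', mul_add 2 s 1, mul_one]
    simp only [hr]
    field_simp
    ring

end MomentRecurrence

namespace BinTree

lemma ord_pos (t : BinTree) : 1 ≤ t.ord := by
  induction t with
  | leaf => simp [ord]
  | node l r hl hr => simp only [ord]; split_ifs <;> omega

lemma ord_eq_one_iff (t : BinTree) : t.ord = 1 ↔ t = leaf := by
  cases t with
  | leaf => simp [ord]
  | node l r =>
    have hl := ord_pos l
    have hr := ord_pos r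
    simp only [ord, reduceCtorEq, iff_false]
    split_ifs <;> omega

lemma branches_two_leaf : branches 2 leaf = 0 := rfl

lemma branches_two_node (l r : BinTree) :
    branches 2 (node l r) = branches 2 l + branches 2 r + if l = leaf ∧ r = leaf then 1 else 0 := by
  have h : (ord l = ord r ∧ ord l + 1 = 2) ↔ (l = leaf ∧ r = leaf) := by
    rw [← ord_eq_one_iff, ← ord_eq_one_iff]
    omega
  simp only [branches, h]

lemma branches_two_pos {t : BinTree} (ht : t ≠ leaf) : 0 < branches 2 t := by
  induction t with
  | leaf => exact absurd rfl ht
  | node l r hl hr =>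
    rw [branches_two_node]
    by_cases h₁ : l = leaf
    · by_cases h₂ : r = leaf
      · simp [h₁, h₂]
      · have := hr h₂
        omega
    · have := hl h₁
      omega

end BinTree

open BinTree

lemma magnitude_of_mem_treesOf {n : ℕ} {t : BinTree} (ht : t ∈ treesOf n) : t.magnitude = n := by
  induction t generalizing n with
  | leaf =>
    match n with
    | 0 => simp [treesOf] at ht
    | 1 => rfl
    | n + 2 => simp [treesOf] at ht
  | node l r hl hr =>
    match n with
    | 0 => simp [treesOf] at ht
    | 1 => simp [treesOf] at ht
    | n + 2 =>
      rw [treesOf] at ht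
      simp only [Finset.mem_biUnion, Finset.mem_attach, Finset.mem_image, Finset.mem_product,
        true_and, Subtype.exists, Finset.mem_range, Prod.exists, node.injEq] at ht
      obtain ⟨k, hk, l', r', ⟨h1, h2⟩, rfl, rfl⟩ := ht
      rw [magnitude, hl h1, hr h2]
      omega

lemma leaf_mem_treesOf_iff (n : ℕ) : leaf ∈ treesOf n ↔ n = 1 := by
  constructor
  · intro h
    exact (magnitude_of_mem_treesOf h).symm
  · rintro rfl
    simp [treesOf]

lemma sum_treesOf_add_two {M : Type*} [AddCommMonoid M] (n : ℕ) (F : BinTree → M) :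
    ∑ t ∈ treesOf (n + 2), F t =
      ∑ k ∈ Finset.range (n + 1), ∑ l ∈ treesOf (k + 1), ∑ r ∈ treesOf (n + 1 - k),
        F (node l r) := by
  rw [treesOf, Finset.sum_biUnion]
  · rw [← Finset.sum_attach (Finset.range (n + 1))]
    refine Finset.sum_congr rfl fun k _ => ?_
    rw [Finset.sum_image, Finset.sum_product]
    rintro ⟨l, r⟩ _ ⟨l', r'⟩ _ h
    simpa using h
  · intro k _ k' _ hkk'
    rw [Function.onFun, Finset.disjoint_left]
    intro t ht ht'
    simp only [Finset.mem_image, Finset.mem_product, Prod.exists] at ht ht'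
    obtain ⟨l, r, ⟨hl, _⟩, rfl⟩ := ht
    obtain ⟨l', r', ⟨hl', _⟩, h⟩ := ht'
    simp only [node.injEq] at h
    obtain ⟨rfl, rfl⟩ := h
    have e1 := magnitude_of_mem_treesOf hl
    have e2 := magnitude_of_mem_treesOf hl'
    exact hkk' (Subtype.ext (by omega))

lemma treesOf_card_pos {n : ℕ} (hn : 1 ≤ n) : 0 < (treesOf n).card := by
  induction n using Nat.strong_induction_on with
  | _ n ih =>
    match n, hn with
    | 1, _ => simp [treesOf]
    | n + 2, _ =>
      rw [Finset.card_eq_sum_ones, sum_treesOf_add_two]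
      simp only [Finset.sum_const, smul_eq_mul]
      refine Finset.sum_pos (fun k hk => ?_) ⟨0, by simp⟩
      have := Finset.mem_range.mp hk
      exact Nat.mul_pos (ih _ (by omega) (by omega)) (by simpa using ih (n + 1 - k) (by omega) (by omega))

/-- The number of trees of magnitude `n` with `m` branches of order two. -/
def treeCount (n m : ℕ) : ℕ := ((treesOf n).filter fun t => branches 2 t = m).card

open Polynomial in
/-- The polynomial enumerating trees of magnitude `n` by their number of order-two branches. -/
noncomputable def branchPoly (n : ℕ) : ℝ[X] := ∑ t ∈ treesOf n, X ^ branches 2 t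

lemma coeff_branchPoly (n m : ℕ) : (branchPoly n).coeff m = treeCount n m := by
  simp [branchPoly, treeCount, Polynomial.coeff_X_pow, eq_comm]

lemma treeCount_zero_left (m : ℕ) : treeCount 0 m = 0 := by
  simp [treeCount, treesOf]

lemma treeCount_zero_right (n : ℕ) : treeCount n 0 = if n = 1 then 1 else 0 := by
  have h : (treesOf n).filter (fun t => branches 2 t = 0) = if n = 1 then {leaf} else ∅ := by
    ext t
    have ht : branches 2 t = 0 ↔ t = leaf := by
      constructor
      · intro h
        by_contra hne
        exact (branches_two_pos hne).ne' h
      · rintro rfl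
        rfl
    rw [Finset.mem_filter, ht]
    constructor
    · rintro ⟨h, rfl⟩
      simp [(leaf_mem_treesOf_iff n).mp h]
    · split_ifs with hn
      · intro h
        rw [Finset.mem_singleton] at h
        subst h
        exact ⟨(leaf_mem_treesOf_iff n).mpr hn, rfl⟩
      · simp
  rw [treeCount, h]
  split_ifs <;> simp

lemma branchPoly_one : branchPoly 1 = 1 := by
  simp [branchPoly, treesOf, branches_two_leaf]

lemma branchPoly_add_two (n : ℕ) :
    branchPoly (n + 2) = ∑ k ∈ Finset.range (n + 1), branchPoly (k + 1) * branchPoly (n + 1 - k)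
      + if n = 0 then Polynomial.X - 1 else 0 := by
  rcases n with _ | n
  · rw [branchPoly, sum_treesOf_add_two]
    simp [branchPoly, treesOf, branches_two_node, branches_two_leaf]
  · rw [branchPoly, sum_treesOf_add_two, if_neg (by omega), add_zero]
    refine Finset.sum_congr rfl fun k hk => ?_
    have hk := Finset.mem_range.mp hk
    rw [branchPoly, branchPoly, Finset.sum_mul_sum]
    refine Finset.sum_congr rfl fun l hl => Finset.sum_congr rfl fun r hr => ?_
    rw [branches_two_node, if_neg, add_zero, pow_add]
    rintro ⟨rfl, rfl⟩
    have e1 := (leaf_mem_treesOf_iff _).mp hl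
    have e2 := (leaf_mem_treesOf_iff _).mp hr
    omega

/-- The generating function in the magnitude of trees with `m` branches of order two. -/
noncomputable def treeSeries (m : ℕ) : PowerSeries ℝ :=
  PowerSeries.mk fun n => (treeCount n m : ℝ)

lemma treeSeries_zero : treeSeries 0 = PowerSeries.X := by
  ext n
  simp [treeSeries, treeCount_zero_right, PowerSeries.coeff_X]

lemma treeCount_add_two (n m : ℕ) :
    (treeCount (n + 2) m : ℝ) = ∑ p ∈ Finset.HasAntidiagonal.antidiagonal (n + 2),
      ∑ q ∈ Finset.HasAntidiagonal.antidiagonal m, (treeCount p.1 q.1 : ℝ) * treeCount p.2 q.2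
      + if n = 0 then (Polynomial.X - 1 : Polynomial ℝ).coeff m else 0 := by
  rw [← coeff_branchPoly, branchPoly_add_two, Polynomial.coeff_add, Polynomial.finsetSum_coeff,
    Finset.Nat.sum_antidiagonal_eq_sum_range_succ_mk, Finset.sum_range_succ _ (n + 2),
    Finset.sum_range_succ' _ (n + 1)]
  congr 1
  · simp only [treeCount_zero_left, Nat.sub_self, Nat.cast_zero, mul_zero, zero_mul,
      Finset.sum_const_zero, add_zero]
    refine Finset.sum_congr rfl fun k _ => ?_
    rw [Polynomial.coeff_mul]
    refine Finset.sum_congr rfl fun q _ => ?_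
    rw [coeff_branchPoly, coeff_branchPoly, show n + 2 - (k + 1) = n + 1 - k by omega]
  · split_ifs <;> simp

lemma treeSeries_eq_convolution (m : ℕ) :
    treeSeries (m + 1) = ∑ q ∈ Finset.HasAntidiagonal.antidiagonal (m + 1), treeSeries q.1 * treeSeries q.2
      + if m = 0 then PowerSeries.X ^ 2 else 0 := by
  ext n
  rw [map_add, map_sum]
  simp only [PowerSeries.coeff_mul, treeSeries, PowerSeries.coeff_mk]
  rw [Finset.sum_comm]
  rcases n with _ | _ | n
  · simp only [treeCount_zero_left]
    split_ifs <;> simp [treeCount_zero_left, PowerSeries.coeff_X_pow]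
  · have h1 : treeCount 1 (m + 1) = 0 := by
      simp [treeCount, treesOf, Finset.filter_singleton, branches_two_leaf]
    rw [zero_add, h1]
    split_ifs <;>
      simp [Finset.Nat.antidiagonal_succ, treeCount_zero_left, PowerSeries.coeff_X_pow]
  · rw [treeCount_add_two]
    congr 1
    rcases n with _ | n <;> rcases m with _ | m <;>
      simp [PowerSeries.coeff_X_pow, Polynomial.coeff_X, Polynomial.coeff_one]

/-- The geometric series of ratio two. -/
noncomputable def geomTwo : PowerSeries ℝ := PowerSeries.rescale 2 (PowerSeries.mk 1)

lemma one_sub_two_X_mul_geomTwo : (1 - 2 * PowerSeries.X) * geomTwo = 1 := by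
  have h := congrArg (PowerSeries.rescale (2 : ℝ)) (PowerSeries.mk_one_mul_one_sub_eq_one ℝ)
  rw [map_mul, map_sub, map_one, PowerSeries.rescale_X, mul_comm, map_ofNat] at h
  exact h

lemma coeff_geomTwo_pow (d n : ℕ) :
    PowerSeries.coeff n (geomTwo ^ (d + 1)) = 2 ^ n * ((d + n).choose d : ℝ) := by
  rw [geomTwo, ← map_pow, PowerSeries.mk_one_pow_eq_mk_choose_add, PowerSeries.coeff_rescale,
    PowerSeries.coeff_mk]

lemma treeSeries_succ (m : ℕ) :
    treeSeries (m + 1) =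
      (catalan m : PowerSeries ℝ) * (PowerSeries.X ^ (2 * m + 2) * geomTwo ^ (2 * m + 1)) := by
  have hsolve (m : ℕ) (R : PowerSeries ℝ)
      (h : treeSeries (m + 1) = 2 * PowerSeries.X * treeSeries (m + 1) + R) :
      treeSeries (m + 1) = geomTwo * R := by
    linear_combination geomTwo * h - treeSeries (m + 1) * one_sub_two_X_mul_geomTwo
  induction m using Nat.strong_induction_on with
  | _ m ih =>
    match m, ih with
    | 0, _ =>
      rw [hsolve 0 (PowerSeries.X ^ 2)]
      · simp
        ring
      · conv_lhs => rw [treeSeries_eq_convolution]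
        simp [Finset.Nat.antidiagonal_succ, treeSeries_zero]
        ring
    | m + 1, ih =>
      rw [hsolve (m + 1) (∑ q ∈ Finset.HasAntidiagonal.antidiagonal m, treeSeries (q.1 + 1) * treeSeries (q.2 + 1))]
      · rw [catalan_succ', Nat.cast_sum, Finset.sum_mul, Finset.mul_sum]
        refine Finset.sum_congr rfl fun q hq => ?_
        have hq := Finset.HasAntidiagonal.mem_antidiagonal.mp hq
        rw [ih q.1 (by omega), ih q.2 (by omega), ← hq]
        push_cast
        ring
      · conv_lhs => rw [treeSeries_eq_convolution, if_neg (by omega),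
          Finset.Nat.antidiagonal_succ_succ']
        simp [treeSeries_zero]
        ring

lemma treeCount_succ (n m : ℕ) :
    (treeCount n (m + 1) : ℝ) =
      if 2 * m + 2 ≤ n then (catalan m : ℝ) * (2 ^ (n - (2 * m + 2)) * ((n - 2).choose (2 * m) : ℝ))
      else 0 := by
  have h := congrArg (PowerSeries.coeff n) (treeSeries_succ m)
  rw [← map_natCast (PowerSeries.C (R := ℝ)), PowerSeries.coeff_C_mul,
    PowerSeries.coeff_X_pow_mul', treeSeries, PowerSeries.coeff_mk] at h
  rw [h]
  split_ifs with hn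
  · rw [coeff_geomTwo_pow, show 2 * m + (n - (2 * m + 2)) = n - 2 by omega]
  · simp

lemma treeCount_ratio (n m : ℕ) :
    4 * (m : ℝ) * (m + 1) * treeCount n (m + 1) =
      ((n : ℝ) - 2 * m) * (n - 2 * m - 1) * treeCount n m := by
  rcases m with _ | m
  · rw [treeCount_zero_right]
    split_ifs with h <;> simp [h]
  · rw [treeCount_succ, treeCount_succ]
    have hcat : ((m : ℝ) + 2) * catalan (m + 1) = 2 * (2 * m + 1) * catalan m := by
      have e1 := succ_mul_catalan_eq_centralBinom m
      have e2 := succ_mul_catalan_eq_centralBinom (m + 1)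
      have e3 := Nat.succ_mul_centralBinom_succ m
      rw [← e1, ← e2] at e3
      have e4 : (m + 2) * catalan (m + 1) = 2 * (2 * m + 1) * catalan m := by
        apply Nat.eq_of_mul_eq_mul_left (Nat.succ_pos m)
        simp only [Nat.succ_eq_add_one]
        linarith
      exact_mod_cast e4
    by_cases h4 : 2 * (m + 1) + 2 ≤ n
    · obtain ⟨d, rfl⟩ := Nat.exists_eq_add_of_le h4
      rw [if_pos h4, if_pos (by omega), show 2 * (m + 1) + 2 + d - (2 * (m + 1) + 2) = d by omega,
        show 2 * (m + 1) + 2 + d - (2 * m + 2) = d + 2 by omega,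
        show 2 * (m + 1) + 2 + d - 2 = 2 * m + 2 + d by omega, show 2 * (m + 1) = 2 * m + 2 by ring]
      have c1 := Nat.choose_succ_right_eq (2 * m + 2 + d) (2 * m)
      have c2 := Nat.choose_succ_right_eq (2 * m + 2 + d) (2 * m + 1)
      rw [show 2 * m + 2 + d - 2 * m = d + 2 by omega] at c1
      rw [show 2 * m + 2 + d - (2 * m + 1) = d + 1 by omega] at c2
      have c1' : ((2 * m + 2 + d).choose (2 * m + 1) : ℝ) * (2 * m + 1) =
        (2 * m + 2 + d).choose (2 * m) * (d + 2) := by exact_mod_cast c1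
      have c2' : ((2 * m + 2 + d).choose (2 * m + 2) : ℝ) * (2 * m + 2) =
        (2 * m + 2 + d).choose (2 * m + 1) * (d + 1) := by exact_mod_cast c2
      push_cast
      have hm : (2 * (m : ℝ) + 1) ≠ 0 := by positivity
      apply mul_left_cancel₀ hm
      rw [pow_add]
      linear_combination
        (2 * (m : ℝ) + 1) * 4 * (m + 1) * 2 ^ d * ((2 * m + 2 + d).choose (2 * m + 2) : ℝ) * hcat
        + (2 * (m : ℝ) + 1) ^ 2 * 4 * catalan m * 2 ^ d * c2'
        + (2 * (m : ℝ) + 1) * 4 * catalan m * 2 ^ d * (d + 1) * c1'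
    · rw [if_neg h4]
      split_ifs with h2
      · have : n = 2 * m + 2 ∨ n = 2 * m + 3 := by omega
        rcases this with rfl | rfl <;> push_cast <;> ring
      · simp

lemma sum_treesOf_eq_sum_treeCount {n M : ℕ} (hM : ∀ t ∈ treesOf n, branches 2 t < M)
    (F : ℕ → ℝ) :
    ∑ t ∈ treesOf n, F (branches 2 t) = ∑ m ∈ Finset.range M, (treeCount n m : ℝ) * F m := by
  rw [← Finset.sum_fiberwise_of_maps_to (t := Finset.range M) (g := branches 2)
    (fun t ht => Finset.mem_range.mpr (hM t ht))]
  refine Finset.sum_congr rfl fun m _ => ?_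
  rw [Finset.sum_congr rfl (g := fun _ => F m), Finset.sum_const, nsmul_eq_mul, treeCount]
  intro t ht
  rw [(Finset.mem_filter.mp ht).2]

/-- A Stein-type identity characterising the law of the number of order-two branches. -/
lemma sum_treesOf_stein (n : ℕ) (F : ℕ → ℝ) :
    ∑ t ∈ treesOf n, 4 * (branches 2 t : ℝ) * (branches 2 t - 1) * F (branches 2 t) =
      ∑ t ∈ treesOf n, ((n : ℝ) - 2 * branches 2 t) * (n - 2 * branches 2 t - 1) *
        F (branches 2 t + 1) := by
  obtain ⟨M, hM⟩ : ∃ M, ∀ t ∈ treesOf n, branches 2 t < M :=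
    ⟨(treesOf n).sup (branches 2) + 1, fun t ht => Nat.lt_succ_of_le (Finset.le_sup ht)⟩
  rw [sum_treesOf_eq_sum_treeCount (M := M + 1) (fun t ht => (hM t ht).trans (Nat.lt_succ_self M))
      (fun m => 4 * (m : ℝ) * (m - 1) * F m),
    sum_treesOf_eq_sum_treeCount hM
      (fun m => ((n : ℝ) - 2 * m) * (n - 2 * m - 1) * F (m + 1)), Finset.sum_range_succ']
  simp only [Nat.cast_zero, mul_zero, zero_mul, add_zero]
  refine Finset.sum_congr rfl fun m _ => ?_
  have := treeCount_ratio n m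
  push_cast
  linear_combination F (m + 1) * this

/-- The central moment of order `j` (about `n / 4`) of the number of order-two branches. -/
noncomputable def centralMoment₂ (j n : ℕ) : ℝ :=
  expect n fun t => ((branches 2 t : ℝ) - (n : ℝ) / 4) ^ j

lemma expect_add (n : ℕ) (f g : BinTree → ℝ) :
    expect n (fun t => f t + g t) = expect n f + expect n g := by
  simp [expect, Finset.sum_add_distrib, add_div]

lemma expect_const_mul (n : ℕ) (c : ℝ) (f : BinTree → ℝ) :
    expect n (fun t => c * f t) = c * expect n f := by
  simp [expect, ← Finset.mul_sum, mul_div_assoc]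

lemma expect_sum {ι : Type*} (n : ℕ) (s : Finset ι) (f : ι → BinTree → ℝ) :
    expect n (fun t => ∑ i ∈ s, f i t) = ∑ i ∈ s, expect n (f i) := by
  rw [expect, Finset.sum_comm, Finset.sum_div]
  rfl

lemma centralMoment₂_zero {n : ℕ} (hn : 1 ≤ n) : centralMoment₂ 0 n = 1 := by
  have : ((treesOf n).card : ℝ) ≠ 0 := by exact_mod_cast (treesOf_card_pos hn).ne'
  simp [centralMoment₂, expect, this]

lemma expect_stein (n k : ℕ) :
    expect n (fun t => 4 * (branches 2 t : ℝ) * (branches 2 t - 1) *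
        ((branches 2 t : ℝ) - (n : ℝ) / 4) ^ k) =
      expect n (fun t => ((n : ℝ) - 2 * branches 2 t) * (n - 2 * branches 2 t - 1) *
        ((branches 2 t : ℝ) - (n : ℝ) / 4 + 1) ^ k) := by
  have h := sum_treesOf_stein n fun m => ((m : ℝ) - (n : ℝ) / 4) ^ k
  rw [expect, expect, h]
  push_cast
  simp only [add_sub_right_comm]

lemma centralMoment₂_sum (n k : ℕ) :
    (4 * (n : ℝ) - 6) * centralMoment₂ (k + 1) n = (0 + 1 / 2 * (n : ℝ)) * centralMoment₂ k n +
      ∑ j ∈ Finset.range k, (k.choose j : ℝ) *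
        (((n : ℝ) ^ 2 / 4 - (n : ℝ) / 2) * centralMoment₂ j n +
          (2 + -2 * (n : ℝ)) * centralMoment₂ (j + 1) n + 4 * centralMoment₂ (j + 2) n) := by
  have h := expect_stein n k
  have hl : expect n (fun t => 4 * (branches 2 t : ℝ) * (branches 2 t - 1) *
        ((branches 2 t : ℝ) - (n : ℝ) / 4) ^ k) =
      ((n : ℝ) ^ 2 / 4 - n) * centralMoment₂ k n + (2 * (n : ℝ) - 4) * centralMoment₂ (k + 1) n +
        4 * centralMoment₂ (k + 2) n := by
    simp only [centralMoment₂, ← expect_const_mul, ← expect_add]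
    congr 1
    funext t
    ring
  have hr : expect n (fun t => ((n : ℝ) - 2 * branches 2 t) * (n - 2 * branches 2 t - 1) *
        ((branches 2 t : ℝ) - (n : ℝ) / 4 + 1) ^ k) =
      ∑ j ∈ Finset.range (k + 1), (k.choose j : ℝ) *
        (((n : ℝ) ^ 2 / 4 - (n : ℝ) / 2) * centralMoment₂ j n +
          (2 + -2 * (n : ℝ)) * centralMoment₂ (j + 1) n + 4 * centralMoment₂ (j + 2) n) := by
    simp only [centralMoment₂, ← expect_const_mul, ← expect_add, ← expect_sum]
    congr 1
    funext t
    rw [add_pow, Finset.mul_sum]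
    refine Finset.sum_congr rfl fun j _ => ?_
    rw [one_pow]
    ring
  rw [hl, hr, Finset.sum_range_succ, Nat.choose_self] at h
  push_cast at h
  linear_combination h

lemma centralMoment₂_one (n : ℕ) :
    (4 * (n : ℝ) - 6) * centralMoment₂ 1 n = (0 + 1 / 2 * (n : ℝ)) * centralMoment₂ 0 n := by
  simpa using centralMoment₂_sum n 0

lemma centralMoment₂_recurrence (k n : ℕ) :
    (4 * (n : ℝ) - (6 + 4 * ((k : ℝ) + 1))) * centralMoment₂ (k + 2) n =
      (0 + 1 / 2 * (n : ℝ)) * centralMoment₂ (k + 1) n + ((k : ℝ) + 1) *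
        (((n : ℝ) ^ 2 / 4 - (n : ℝ) / 2) * centralMoment₂ k n +
          (2 + -2 * (n : ℝ)) * centralMoment₂ (k + 1) n)
        + lowerTerms centralMoment₂ k n := by
  have h := centralMoment₂_sum n (k + 1)
  rw [Finset.sum_range_succ, Nat.choose_succ_self_right] at h
  push_cast at h
  rw [lowerTerms]
  linear_combination h

/-- Even central moments of `S_{2,n}` (Lemma 3, even case): for fixed `s ≥ 0`,
`⟨(S_{2,n} − n/4)^{2s}⟩ ∼ ((2s−1)!!/4^{2s}) n^s`. -/
theorem even_central_moments_S2 (s : ℕ) :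
    Tendsto (fun n : ℕ =>
        expect n (fun τ => ((BinTree.branches 2 τ : ℝ) - (n : ℝ) / 4) ^ (2*s))
          / ((Nat.doubleFactorial (2*s - 1) : ℝ) / 4 ^ (2*s) * (n : ℝ) ^ s))
      atTop (𝓝 1) := by
  have h0 : ∀ᶠ n in atTop, centralMoment₂ 0 n = 1 := by
    filter_upwards [eventually_ge_atTop 1] with n hn using centralMoment₂_zero hn
  have h := even_moments_tendsto h0 centralMoment₂_one centralMoment₂_recurrence s
  have hc : (Nat.doubleFactorial (2 * s - 1) : ℝ) / 4 ^ (2 * s) ≠ 0 := by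
    have := Nat.doubleFactorial_pos (2 * s - 1)
    positivity
  have h' := h.div_const ((Nat.doubleFactorial (2 * s - 1) : ℝ) / 4 ^ (2 * s))
  rw [div_self hc] at h'
  refine h'.congr fun n => ?_
  rw [div_div, mul_comm ((n : ℝ) ^ s)]
  rfl
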